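/- For every n ≥ 2 there exist integers t < m with binom(m, t) ≥ n and 2^t · m^2 · 2^t ≤ e^{C√(log n)} for an absolute constant C; consequently the coloring σ(vw) = (c1(vw), c2(vw), f_S(S∩T), f_T(S∩T)) on t-subsets of [m] uses at most e^{O(√(log n))} colors while coloring at least n vertices. -/

import Mathlib

/-- Choosing `t` elements out of `t * (a + 1)` can be done in at least `a ^ t` ways. -/
theorem pow_le_choose_mul_add (a t : ℕ) : a ^ t ≤ (t * (a + 1)).choose t := by
  have h1 : (t * a) ^ t ≤ (t * (a + 1)).descFactorial t := by
    refine le_trans (Nat.pow_le_pow_left ?_ t) (Nat.pow_sub_le_descFactorial _ _)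
    rw [mul_add, mul_one]
    omega
  rw [Nat.descFactorial_eq_factorial_mul_choose, mul_pow] at h1
  have h2 : t.factorial * a ^ t ≤ t.factorial * (t * (a + 1)).choose t :=
    le_trans (Nat.mul_le_mul_right _ (Nat.factorial_le_pow t)) h1
  exact Nat.le_of_mul_le_mul_left h2 t.factorial_pos

theorem sqrt_log_two_le (n : ℕ) (hn : n ≠ 0) :
    (Nat.sqrt (Nat.log 2 n) : ℝ) ≤ 2 * Real.sqrt (Real.log n) := by
  set s := Nat.sqrt (Nat.log 2 n)
  have hpow : 2 ^ (s * s) ≤ n :=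
    (Nat.pow_le_pow_right two_pos (Nat.sqrt_le _)).trans (Nat.pow_log_le_self 2 hn)
  have hlog : ((s * s : ℕ) : ℝ) * Real.log 2 ≤ Real.log n := by
    rw [← Real.log_pow]
    exact Real.log_le_log (by positivity) (by exact_mod_cast hpow)
  have h2 := Real.log_two_gt_d9
  have h : (s : ℝ) / 2 ≤ Real.sqrt (Real.log n) := by
    apply Real.le_sqrt_of_sq_le
    push_cast at hlog
    nlinarith [mul_self_nonneg (s : ℝ)]
  linarith

theorem stmt_17 :
    ∃ C : ℝ, 0 < C ∧ ∀ n : ℕ, 2 ≤ n →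
      ∃ t m : ℕ, t < m ∧ n ≤ m.choose t ∧
        ((2 ^ t * m ^ 2 * 2 ^ t : ℕ) : ℝ) ≤ Real.exp (C * Real.sqrt (Real.log n)) := by
  refine ⟨32, by norm_num, fun n hn => ?_⟩
  have hsqrt := sqrt_log_two_le n (by omega)
  have hs : 0 < Nat.sqrt (Nat.log 2 n) := Nat.sqrt_pos.2 (Nat.log_pos one_lt_two hn)
  have hlt := Nat.lt_succ_sqrt (Nat.log 2 n)
  set s := Nat.sqrt (Nat.log 2 n)
  set t := s + 1 with ht
  refine ⟨t, t * (2 ^ t + 1), ?_, ?_, ?_⟩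
  · exact lt_mul_of_one_lt_right (by omega) (by have := Nat.two_pow_pos t; omega)
  · refine le_trans ?_ (pow_le_choose_mul_add (2 ^ t) t)
    rw [← pow_mul]
    exact (Nat.lt_pow_succ_log_self one_lt_two n).le.trans (Nat.pow_le_pow_right two_pos hlt)
  · have hm : t * (2 ^ t + 1) ≤ 2 ^ (3 * t) := by
      have h1 : 2 ^ t + 1 ≤ 2 ^ (2 * t) := by
        have : 2 ^ (t + 1) ≤ 2 ^ (2 * t) := Nat.pow_le_pow_right two_pos (by omega)
        rw [pow_succ] at this
        have := Nat.two_pow_pos t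
        omega
      calc t * (2 ^ t + 1) ≤ 2 ^ t * 2 ^ (2 * t) := Nat.mul_le_mul Nat.lt_two_pow_self.le h1
        _ = 2 ^ (3 * t) := by ring
    have hcount : 2 ^ t * (t * (2 ^ t + 1)) ^ 2 * 2 ^ t ≤ 2 ^ (16 * s) :=
      calc 2 ^ t * (t * (2 ^ t + 1)) ^ 2 * 2 ^ t ≤ 2 ^ t * (2 ^ (3 * t)) ^ 2 * 2 ^ t := by gcongr
        _ = 2 ^ (8 * t) := by ring
        _ ≤ 2 ^ (16 * s) := Nat.pow_le_pow_right two_pos (by omega)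
    have hexp : (2 : ℝ) ≤ Real.exp 1 := by
      have := Real.add_one_le_exp 1
      linarith
    calc ((2 ^ t * (t * (2 ^ t + 1)) ^ 2 * 2 ^ t : ℕ) : ℝ) ≤ 2 ^ (16 * s) := by
          exact_mod_cast hcount
      _ ≤ Real.exp 1 ^ (16 * s) := by gcongr
      _ = Real.exp (16 * s) := by
          rw [← Real.exp_nat_mul]
          push_cast
          ring_nf
      _ ≤ Real.exp (32 * Real.sqrt (Real.log n)) := Real.exp_le_exp.2 (by linarith)
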